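/- arXiv:1204.2182 — 2 statements merged into one kernel-verified Lean document; each statement's English description precedes it below -/
import Mathlib

section
/- Differentiation under the integral of the logarithm of a difference quotient: Let μ be a finite Borel measure on ℝ with compact support K, and let f : ℝ → ℝ be a polynomial. Let 𝒥f be the unique two-variable polynomial with 𝒥f(x,y)·(x−y) = f(x) − f(y), and let h be the unique two-variable polynomial with h(x,y)·(x−y)² = f'(x)·(x−y) − f(x) + f(y). Let U ⊆ ℝ be an open set such that 1 + 𝒥f(x,y) > 0 for all x ∈ U and y ∈ K. Then the function x ↦ ∫_K log(1 + 𝒥f(x,y)) dμ(y) is differentiable on U, with derivative at each x ∈ U equal to ∫_K h(x,y) / (1 + 𝒥f(x,y)) dμ(y). -/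
open MeasureTheory

/-- Differentiation under the integral sign over a compact set, for an integrand that is
continuous in the variable of integration and has a jointly continuous partial derivative. -/
theorem hasDerivAt_setIntegral_of_isCompact
    {Y : Type*} [TopologicalSpace Y] [T2Space Y] [SecondCountableTopology Y]
    [MeasurableSpace Y] [BorelSpace Y] {μ : Measure Y} [IsFiniteMeasureOnCompacts μ]
    {K : Set Y} (hK : IsCompact K) {U : Set ℝ} (hU : IsOpen U) {F F' : ℝ → Y → ℝ}
    (hF : ∀ x ∈ U, ContinuousOn (F x) K)
    (hF' : ContinuousOn (fun p : ℝ × Y ↦ F' p.1 p.2) (U ×ˢ K))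
    (hderiv : ∀ x ∈ U, ∀ y ∈ K, HasDerivAt (F · y) (F' x y) x) {x : ℝ} (hx : x ∈ U) :
    HasDerivAt (fun x' ↦ ∫ y in K, F x' y ∂μ) (∫ y in K, F' x y ∂μ) x := by
  obtain ⟨ε, hε, hball⟩ := Metric.nhds_basis_closedBall.mem_iff.1 (hU.mem_nhds hx)
  obtain ⟨C, hC⟩ := ((isCompact_closedBall x ε).prod hK).exists_bound_of_continuousOn
    (hF'.mono (Set.prod_mono hball subset_rfl))
  have hF'x : ContinuousOn (F' x) K :=
    hF'.comp (by fun_prop : ContinuousOn (fun y : Y ↦ (x, y)) K) fun y hy ↦ ⟨hx, hy⟩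
  have hKm := hK.measurableSet
  refine (hasDerivAt_integral_of_dominated_loc_of_deriv_le (bound := fun _ ↦ C)
    (Metric.closedBall_mem_nhds x hε) ?_ ((hF x hx).integrableOn_compact hK)
    (hF'x.aestronglyMeasurable hKm) ?_ (integrableOn_const hK.measure_lt_top.ne) ?_).2
  · filter_upwards [hU.mem_nhds hx] with x' hx'
    exact (hF x' hx').aestronglyMeasurable hKm
  · filter_upwards [ae_restrict_mem hKm] with y hy x' hx'
    exact hC (x', y) ⟨hx', hy⟩
  · filter_upwards [ae_restrict_mem hKm] with y hy x' hx'
    exact hderiv x' (hball hx') y hy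

open Polynomial in
/-- Evaluating a two-variable polynomial at a fixed second coordinate gives a
one-variable polynomial function. -/
theorem eval_aeval_X_C (p : MvPolynomial (Fin 2) ℝ) (x y : ℝ) :
    (MvPolynomial.aeval ![(X : ℝ[X]), C y] p).eval x = MvPolynomial.eval ![x, y] p := by
  rw [← Polynomial.coe_aeval_eq_eval, ← AlgHom.comp_apply,
    MvPolynomial.comp_aeval, MvPolynomial.aeval_eq_eval]
  congr 2
  ext i
  fin_cases i <;> simp

open Polynomial in
/-- The partial derivative in the first variable of the polynomial difference quotient of `f`. -/
theorem hasDerivAt_difference_quotient {f : ℝ[X]} {Jf h : MvPolynomial (Fin 2) ℝ}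
    (hJf : ∀ x y : ℝ, MvPolynomial.eval ![x, y] Jf * (x - y) = f.eval x - f.eval y)
    (hh : ∀ x y : ℝ, MvPolynomial.eval ![x, y] h * (x - y) ^ 2 =
      (derivative f).eval x * (x - y) - f.eval x + f.eval y) (x y : ℝ) :
    HasDerivAt (fun x' ↦ MvPolynomial.eval ![x', y] Jf) (MvPolynomial.eval ![x, y] h) x := by
  set P := MvPolynomial.aeval ![(X : ℝ[X]), C y] Jf with hP
  set H := MvPolynomial.aeval ![(X : ℝ[X]), C y] h with hH
  have hPf : P * (X - C y) = f - C (f.eval y) := by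
    refine Polynomial.funext fun t ↦ ?_
    simpa [hP, eval_aeval_X_C] using hJf t y
  have hHf : H * (X - C y) ^ 2 = derivative f * (X - C y) - f + C (f.eval y) := by
    refine Polynomial.funext fun t ↦ ?_
    simpa [hH, eval_aeval_X_C] using hh t y
  have hPd : derivative P * (X - C y) + P = derivative f := by
    simpa using congrArg derivative hPf
  have hPH : derivative P = H := by
    refine mul_right_cancel₀ (pow_ne_zero 2 (X_sub_C_ne_zero y)) ?_
    linear_combination (X - C y) * hPd - hPf - hHf
  have := P.hasDerivAt x
  rw [hPH] at this
  simpa only [hP, hH, eval_aeval_X_C] using this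

/-- Differentiation under the integral of the logarithm of a difference
quotient: with `𝒥f` the polynomial difference quotient of a real polynomial `f`, and `h`
the polynomial with `h(x,y)(x−y)² = f'(x)(x−y) − f(x) + f(y)`, if `1 + 𝒥f(x,y) > 0` for
`x ∈ U`, `y ∈ K`, then `x ↦ ∫_K log(1 + 𝒥f(x,y)) dμ(y)` is differentiable on `U` with
derivative `∫_K h(x,y)/(1 + 𝒥f(x,y)) dμ(y)`. -/
theorem deriv_integral_log_difference_quotient
    (μ : Measure ℝ) [IsFiniteMeasure μ]
    (K : Set ℝ) (hKcompact : IsCompact K) (hμK : μ Kᶜ = 0)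
    (f : Polynomial ℝ)
    (Jf : MvPolynomial (Fin 2) ℝ)
    (hJf : ∀ x y : ℝ,
      MvPolynomial.eval ![x, y] Jf * (x - y) = f.eval x - f.eval y)
    (h : MvPolynomial (Fin 2) ℝ)
    (hh : ∀ x y : ℝ,
      MvPolynomial.eval ![x, y] h * (x - y) ^ 2 =
        (Polynomial.derivative f).eval x * (x - y) - f.eval x + f.eval y)
    (U : Set ℝ) (hU : IsOpen U)
    (hpos : ∀ x ∈ U, ∀ y ∈ K, 0 < 1 + MvPolynomial.eval ![x, y] Jf) :
    ∀ x ∈ U,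
      HasDerivAt
        (fun x' : ℝ => ∫ y in K, Real.log (1 + MvPolynomial.eval ![x', y] Jf) ∂μ)
        (∫ y in K, MvPolynomial.eval ![x, y] h / (1 + MvPolynomial.eval ![x, y] Jf) ∂μ)
        x := by
  intro x hx
  have hcont (p : MvPolynomial (Fin 2) ℝ) :
      Continuous fun q : ℝ × ℝ ↦ MvPolynomial.eval ![q.1, q.2] p :=
    p.continuous_eval.comp (by fun_prop)
  refine hasDerivAt_setIntegral_of_isCompact hKcompact hU
    (F := fun x y ↦ Real.log (1 + MvPolynomial.eval ![x, y] Jf))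
    (F' := fun x y ↦ MvPolynomial.eval ![x, y] h / (1 + MvPolynomial.eval ![x, y] Jf))
    (fun x hx ↦ ?_) ?_ (fun x hx y hy ↦ ?_) hx
  · exact (continuous_const.add ((hcont Jf).comp (Continuous.prodMk_right x))).continuousOn.log
      fun y hy ↦ (hpos x hx y hy).ne'
  · exact (hcont h).continuousOn.div (continuous_const.add (hcont Jf)).continuousOn
      fun q hq ↦ (hpos q.1 hq.1 q.2 hq.2).ne'
  · exact ((hasDerivAt_difference_quotient hJf hh x y).const_add 1).log (hpos x hx y hy).ne'
end

section
/- Principal value Hilbert transform of the semicircle law: Let η be the standard semicircle distribution on [−2,2], i.e. dη(y) = (1/(2π))·√(4 − y²)·1_{[−2,2]}(y) dy. Then for every x ∈ [−2,2], lim_{ε → 0⁺} ∫_{{y ∈ [−2,2] : |y − x| ≥ ε}} (1/(x − y)) dη(y) = x/2. Equivalently, 2·p.v.∫ dη(y)/(x−y) = x on [−2,2]. -/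
open MeasureTheory

/-- The standard semicircle distribution on `[−2,2]`:
`dη(y) = (1/(2π))·√(4 − y²)·1_{[−2,2]}(y) dy`. -/
noncomputable def semicircle : Measure ℝ :=
  volume.withDensity fun y =>
    ENNReal.ofReal
      ((Set.Icc (-2 : ℝ) 2).indicator
        (fun y' => Real.sqrt (4 - y' ^ 2) / (2 * Real.pi)) y)

/-- An antiderivative of `y ↦ √(4 − y²) / (x − y)` on `[−2,2] \ {x}`. -/
noncomputable def hilbertPrimitive (x y : ℝ) : ℝ :=
  √(4 - x ^ 2) *
      (Real.log (4 - x * y + √(4 - x ^ 2) * √(4 - y ^ 2)) - Real.log (y - x)) +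
    (x * Real.arcsin (y / 2) - √(4 - y ^ 2))

lemma four_sub_mul_add_sqrt_pos {x y : ℝ} (hx : x ∈ Set.Icc (-2 : ℝ) 2)
    (hy : y ∈ Set.Icc (-2 : ℝ) 2) (hxy : y ≠ x) :
    0 < 4 - x * y + √(4 - x ^ 2) * √(4 - y ^ 2) := by
  obtain ⟨hx1, hx2⟩ := hx
  obtain ⟨hy1, hy2⟩ := hy
  have hsq : 0 < (y - x) ^ 2 := by
    have := sub_ne_zero.mpr hxy
    positivity
  have : 0 ≤ √(4 - x ^ 2) * √(4 - y ^ 2) := by positivity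
  nlinarith

lemma hasDerivAt_hilbertPrimitive {x y : ℝ} (hx : x ∈ Set.Icc (-2 : ℝ) 2)
    (hy : y ∈ Set.Ioo (-2 : ℝ) 2) (hxy : y ≠ x) :
    HasDerivAt (hilbertPrimitive x) (√(4 - y ^ 2) / (x - y)) y := by
  have hpos := four_sub_mul_add_sqrt_pos hx (Set.Ioo_subset_Icc_self hy) hxy
  obtain ⟨hx1, hx2⟩ := hx
  obtain ⟨hy1, hy2⟩ := hy
  have hr2 : 0 < 4 - y ^ 2 := by nlinarith
  have hs2 : 0 ≤ 4 - x ^ 2 := by nlinarith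
  have hr : 0 < √(4 - y ^ 2) := Real.sqrt_pos.mpr hr2
  have dr : HasDerivAt (fun y : ℝ => √(4 - y ^ 2)) (-(2 * y) / (2 * √(4 - y ^ 2))) y := by
    refine HasDerivAt.sqrt ?_ hr2.ne'
    simpa using (hasDerivAt_pow 2 y).const_sub 4
  have dlog := (((hasDerivAt_id' y).const_mul x).const_sub 4).add (dr.const_mul (√(4 - x ^ 2)))
  have dlog' := (dlog.log hpos.ne').sub
    (((hasDerivAt_id' y).sub_const x).log (sub_ne_zero.mpr hxy))
  have darcsin : HasDerivAt (fun y : ℝ => Real.arcsin (y / 2)) (1 / √(4 - y ^ 2)) y := by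
    have h := (Real.hasDerivAt_arcsin (x := y / 2) (by linarith) (by linarith)).comp y
      ((hasDerivAt_id' y).div_const 2)
    have he : √(1 - (y / 2) ^ 2) = √(4 - y ^ 2) / 2 := by
      rw [show 1 - (y / 2) ^ 2 = (4 - y ^ 2) / 2 ^ 2 by ring, Real.sqrt_div' _ (by positivity),
        Real.sqrt_sq (by norm_num)]
    refine h.congr_deriv ?_
    rw [he]
    field_simp
  refine ((dlog'.const_mul (√(4 - x ^ 2))).add ((darcsin.const_mul x).sub dr)).congr_deriv ?_
  have hr' := Real.sq_sqrt hr2.le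
  have hs' := Real.sq_sqrt hs2
  simp only [Pi.add_apply]
  generalize √(4 - y ^ 2) = r at *
  generalize √(4 - x ^ 2) = s at *
  have hyx : y - x ≠ 0 := sub_ne_zero.mpr hxy
  have hxy' : x - y ≠ 0 := sub_ne_zero.mpr hxy.symm
  have hlog : (-(x * 1) + s * (-(2 * y) / (2 * r))) / (4 - x * y + s * r) - 1 / (y - x) =
      s / (r * (x - y)) := by
    have hp := hpos.ne'
    rw [show s / (r * (x - y)) = -(s / (r * (y - x))) by
      rw [← neg_sub y x, mul_neg, div_neg]]
    field_simp
    linear_combination r * hs' + (-s) * hr'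
  rw [hlog]
  field_simp
  linear_combination hs' - hr'

lemma continuousAt_hilbertPrimitive {x y : ℝ} (hx : x ∈ Set.Icc (-2 : ℝ) 2)
    (hy : y ∈ Set.Icc (-2 : ℝ) 2) (hxy : y ≠ x) :
    ContinuousAt (hilbertPrimitive x) y := by
  have hpos := (four_sub_mul_add_sqrt_pos hx hy hxy).ne'
  have hyx : y - x ≠ 0 := sub_ne_zero.mpr hxy
  unfold hilbertPrimitive
  fun_prop (disch := assumption)

lemma continuousOn_sqrt_div_sub {x : ℝ} {s : Set ℝ} (hs : x ∉ s) :
    ContinuousOn (fun y => √(4 - y ^ 2) / (x - y)) s :=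
  ContinuousOn.div (by fun_prop) (by fun_prop) fun _ hy =>
    sub_ne_zero.mpr (ne_of_mem_of_not_mem hy hs).symm

lemma setIntegral_sqrt_div_sub {x a b : ℝ} (hx : x ∈ Set.Icc (-2 : ℝ) 2) (ha : -2 ≤ a)
    (hab : a ≤ b) (hb : b ≤ 2) (hxab : x ∉ Set.Icc a b) :
    ∫ y in Set.Icc a b, √(4 - y ^ 2) / (x - y) =
      hilbertPrimitive x b - hilbertPrimitive x a := by
  rw [integral_Icc_eq_integral_Ioc, ← intervalIntegral.integral_of_le hab]
  refine intervalIntegral.integral_eq_sub_of_hasDerivAt_of_le hab ?_ ?_ ?_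
  · exact fun y hy => (continuousAt_hilbertPrimitive hx ⟨ha.trans hy.1, hy.2.trans hb⟩
      (ne_of_mem_of_not_mem hy hxab)).continuousWithinAt
  · exact fun y hy => hasDerivAt_hilbertPrimitive hx ⟨ha.trans_lt hy.1, hy.2.trans_le hb⟩
      (ne_of_mem_of_not_mem (Set.Ioo_subset_Icc_self hy) hxab)
  · exact ContinuousOn.intervalIntegrable_of_Icc hab (continuousOn_sqrt_div_sub hxab)

lemma setIntegral_semicircle {s : Set ℝ} (hs : MeasurableSet s) (hs2 : s ⊆ Set.Icc (-2) 2)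
    (g : ℝ → ℝ) :
    ∫ y in s, g y ∂semicircle = (∫ y in s, √(4 - y ^ 2) * g y) / (2 * Real.pi) := by
  unfold semicircle
  rw [setIntegral_withDensity_eq_setIntegral_toReal_smul _ (by simp) _ hs, ← integral_div]
  · refine setIntegral_congr_fun hs fun y hy => ?_
    simp only [Set.indicator_of_mem (hs2 hy), smul_eq_mul]
    rw [ENNReal.toReal_ofReal (by positivity)]
    ring
  · exact ((Measurable.indicator (by fun_prop) measurableSet_Icc)).ennreal_ofReal

lemma truncated_integral_semicircle {x ε : ℝ} (hx : x ∈ Set.Icc (-2 : ℝ) 2) (hε : 0 < ε) :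
    ∫ y in {y : ℝ | y ∈ Set.Icc (-2 : ℝ) 2 ∧ ε ≤ |y - x|}, (x - y)⁻¹ ∂semicircle =
      ((hilbertPrimitive x (max (-2) (x - ε)) - hilbertPrimitive x (-2)) +
        (hilbertPrimitive x 2 - hilbertPrimitive x (min 2 (x + ε)))) / (2 * Real.pi) := by
  have hset : {y : ℝ | y ∈ Set.Icc (-2 : ℝ) 2 ∧ ε ≤ |y - x|} =
      Set.Icc (-2) (x - ε) ∪ Set.Icc (x + ε) 2 := by
    obtain ⟨hx1, hx2⟩ := hx
    ext y
    simp only [Set.mem_ofPred_eq, Set.mem_union, Set.mem_Icc, le_abs]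
    grind
  have hxl : x ∉ Set.Icc (-2) (x - ε) := fun h => by linarith [h.2]
  have hxr : x ∉ Set.Icc (x + ε) 2 := fun h => by linarith [h.1]
  rw [setIntegral_semicircle (hset ▸ measurableSet_Icc.union measurableSet_Icc)
    fun y hy => hy.1, hset]
  simp only [← div_eq_mul_inv]
  rw [setIntegral_union _ measurableSet_Icc (continuousOn_sqrt_div_sub hxl).integrableOn_Icc
    (continuousOn_sqrt_div_sub hxr).integrableOn_Icc]
  · congr 2
    · rcases le_total (-2) (x - ε) with h | h
      · rw [setIntegral_sqrt_div_sub hx le_rfl h (by linarith [hx.2]) hxl, max_eq_right h]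
      · rw [max_eq_left h, sub_self, integral_Icc_eq_integral_Ioc, Set.Ioc_eq_empty h.not_gt,
          setIntegral_empty]
    · rcases le_total (x + ε) 2 with h | h
      · rw [setIntegral_sqrt_div_sub hx (by linarith [hx.1]) h le_rfl hxr, min_eq_right h]
      · rw [min_eq_left h, sub_self, integral_Icc_eq_integral_Ioc, Set.Ioc_eq_empty h.not_gt,
          setIntegral_empty]
  · exact Set.disjoint_left.mpr fun y hy hy' => by linarith [hy.2, hy'.1]

lemma hilbertPrimitive_two_sub (x : ℝ) :
    hilbertPrimitive x 2 - hilbertPrimitive x (-2) = x * Real.pi := by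
  have h1 : Real.arcsin (2 / 2) = Real.pi / 2 := by norm_num
  have h2 : Real.arcsin (-2 / 2) = -(Real.pi / 2) := by norm_num
  have hz : √(4 - (2 : ℝ) ^ 2) = 0 := by norm_num
  have hz' : √(4 - (-2 : ℝ) ^ 2) = 0 := by norm_num
  simp only [hilbertPrimitive, h1, h2, hz, hz']
  rcases eq_or_ne (√(4 - x ^ 2)) 0 with h | h
  · rw [h]
    ring
  · have hx4 : 0 < 4 - x ^ 2 := Real.sqrt_ne_zero'.mp h
    have hl : 2 - x ≠ 0 := fun h => by nlinarith
    have hr : 2 + x ≠ 0 := fun h => by nlinarith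
    rw [show 4 - x * 2 + √(4 - x ^ 2) * 0 = 2 * (2 - x) by ring,
      show 4 - x * -2 + √(4 - x ^ 2) * 0 = 2 * (2 + x) by ring,
      show -2 - x = -(2 + x) by ring, Real.log_neg_eq_log, Real.log_mul two_ne_zero hl,
      Real.log_mul two_ne_zero hr]
    ring

lemma tendsto_hilbertPrimitive_sub {x : ℝ} (hx : x ∈ Set.Icc (-2 : ℝ) 2) :
    Filter.Tendsto
      (fun ε : ℝ => hilbertPrimitive x (max (-2) (x - ε)) - hilbertPrimitive x (min 2 (x + ε)))
      (nhdsWithin 0 (Set.Ioi 0)) (nhds 0) := by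
  rcases eq_or_ne (√(4 - x ^ 2)) 0 with h | h
  · simp only [hilbertPrimitive, h, zero_mul, zero_add]
    refine (Continuous.tendsto' (by fun_prop) 0 0 ?_).mono_left nhdsWithin_le_nhds
    simp [hx.1, hx.2]
  · have hx4 : 0 < 4 - x ^ 2 := Real.sqrt_ne_zero'.mp h
    have hl : -2 < x := by nlinarith [hx.1, hx.2]
    have hr : x < 2 := by nlinarith [hx.1, hx.2]
    set P : ℝ → ℝ := fun y =>
      √(4 - x ^ 2) * Real.log (4 - x * y + √(4 - x ^ 2) * √(4 - y ^ 2)) +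
        (x * Real.arcsin (y / 2) - √(4 - y ^ 2)) with hP
    have hPx : ContinuousAt P x := by
      have : 4 - x * x + √(4 - x ^ 2) * √(4 - x ^ 2) ≠ 0 := by
        have := mul_self_nonneg (√(4 - x ^ 2))
        nlinarith
      fun_prop (disch := assumption)
    have hlim : Filter.Tendsto (fun ε : ℝ => P (x - ε) - P (x + ε))
        (nhdsWithin 0 (Set.Ioi 0)) (nhds 0) := by
      have h1 : Filter.Tendsto (fun ε : ℝ => x - ε) (nhds 0) (nhds x) :=
        Continuous.tendsto' (by fun_prop) _ _ (by simp)
      have h2 : Filter.Tendsto (fun ε : ℝ => x + ε) (nhds 0) (nhds x) :=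
        Continuous.tendsto' (by fun_prop) _ _ (by simp)
      simpa using ((hPx.tendsto.comp h1).sub (hPx.tendsto.comp h2)).mono_left nhdsWithin_le_nhds
    refine hlim.congr' ?_
    filter_upwards [Ioo_mem_nhdsGT (show 0 < min (x + 2) (2 - x) by
      apply lt_min <;> linarith)] with ε hε
    have h1 := hε.2.trans_le (min_le_left _ _)
    have h2 := hε.2.trans_le (min_le_right _ _)
    rw [max_eq_right (by linarith), min_eq_right (by linarith)]
    simp only [hP, hilbertPrimitive]
    rw [show x - ε - x = -ε by ring, show x + ε - x = ε by ring, Real.log_neg_eq_log]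
    ring

/-- Principal value Hilbert transform of the semicircle law: for every
`x ∈ [−2,2]`,
`lim_{ε→0⁺} ∫_{{y ∈ [−2,2] : |y−x| ≥ ε}} (x−y)⁻¹ dη(y) = x/2`. -/
theorem semicircle_principal_value_hilbert_transform
    (x : ℝ) (hx : x ∈ Set.Icc (-2 : ℝ) 2) :
    Filter.Tendsto
      (fun ε : ℝ =>
        ∫ y in {y : ℝ | y ∈ Set.Icc (-2 : ℝ) 2 ∧ ε ≤ |y - x|}, (x - y)⁻¹ ∂semicircle)
      (nhdsWithin 0 (Set.Ioi 0)) (nhds (x / 2)) := by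
  have hlim := (((tendsto_hilbertPrimitive_sub hx).add_const
    (hilbertPrimitive x 2 - hilbertPrimitive x (-2))).div_const (2 * Real.pi))
  rw [hilbertPrimitive_two_sub x, zero_add,
    show x * Real.pi / (2 * Real.pi) = x / 2 by field_simp] at hlim
  refine hlim.congr' ?_
  filter_upwards [self_mem_nhdsWithin] with ε hε
  rw [truncated_integral_semicircle hx hε, ← hilbertPrimitive_two_sub x]
  ring
end
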